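/- There is no Jordan algebra J over a field k of characteristic ≠ 2 possessing an idempotent e and a nilpotent ideal N such that dim_k N = 3, N^⟨3⟩ ≠ 0, N^⟨4⟩ = 0 (so N has nilpotency type (1,1,1)), N ⊆ J_0(e) + J_1(e), and both N ∩ J_0(e) ≠ 0 and N ∩ J_1(e) ≠ 0. -/

import Mathlib

variable {k : Type*} [Field k] {J : Type*} [NonUnitalNonAssocCommRing J]
  [Module k J] [SMulCommClass k J J] [IsScalarTower k J J]

/-- The Peirce component `J_c(e) = {x ∈ J : e·x = c·x}`, a `k`-subspace of `J`. -/
def peirceComp (e : J) (c : k) : Submodule k J where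
  carrier := {x : J | e * x = c • x}
  add_mem' := by
    intro a b ha hb
    simp only [Set.mem_setOf_eq] at *
    rw [mul_add, ha, hb, smul_add]
  zero_mem' := by simp
  smul_mem' := by
    intro r x hx
    simp only [Set.mem_setOf_eq] at *
    rw [mul_smul_comm, hx, smul_comm]

/-- For subspaces `A, B ⊆ J`, `A·B` is the `k`-subspace spanned by all products `a·b`
with `a ∈ A`, `b ∈ B`. -/
def submoduleMul (A B : Submodule k J) : Submodule k J :=
  Submodule.span k {z : J | ∃ a ∈ A, ∃ b ∈ B, z = a * b}

/-- The descending series of a subspace `N`: `nseries N 0 = N^⟨1⟩ = N` and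
`nseries N m = N^⟨m+1⟩ = N^⟨m⟩·N`. -/
def nseries (N : Submodule k J) : ℕ → Submodule k J
  | 0 => N
  | m + 1 => submoduleMul (nseries N m) N

lemma aux_two (hchar : (2 : k) ≠ 0) (v : J) (h : v + v = 0) : v = 0 := by
  have : (2 : k) • v = 0 := by rw [two_smul, h]
  exact (smul_eq_zero.mp this).resolve_left hchar

lemma aux_lin (hchar : (2 : k) ≠ 0)
    (hJordan : ∀ x y : J, ((x * x) * y) * x = (x * x) * (y * x))
    (e : J) (he : e * e = e) (y z : J) :
    ((e * z) * y) * e + ((e * z) * y) * e + (e * y) * z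
      = (e * z) * (y * e) + (e * z) * (y * e) + e * (y * z) := by
  have h1 := hJordan (e + z) y
  have h2 := hJordan (e - z) y
  have h3 := hJordan z y
  simp only [add_mul, mul_add, sub_mul, mul_sub, he, mul_comm z e] at h1 h2
  rw [← sub_eq_zero]
  apply aux_two hchar
  rw [← sub_eq_zero] at h1 h2 h3
  have h4 : (0 : J) = 0 - 0 - (0 + 0) := by simp
  rw [h4]
  nth_rewrite 1 [← h1]
  nth_rewrite 1 [← h2]
  nth_rewrite 1 [← h3]
  nth_rewrite 1 [← h3]
  abel

lemma aux_main (e : J) (N : Submodule k J) (hdimN : Module.finrank k ↥N = 3)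
    (hideal : ∀ x ∈ N, ∀ y : J, x * y ∈ N)
    (h4 : ∀ x ∈ N, ∀ y ∈ N, ∀ z ∈ N, ∀ t ∈ N, ((x * y) * z) * t = 0)
    (c d : k) (hcd : c ≠ d)
    (hcl : ∀ x y : J, e * x = c • x → e * y = c • y → e * (x * y) = c • (x * y))
    (x y z w : J) (hx : x ∈ N) (hy : y ∈ N) (hz : z ∈ N) (hw : w ∈ N)
    (ex : e * x = c • x) (ey : e * y = c • y) (ez : e * z = c • z) (ew : e * w = d • w)
    (hw0 : w ≠ 0) (hne : (x * y) * z ≠ 0) : False := by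
  have hp : x * y ∈ N := hideal x hx y
  have hq : x * y * z ∈ N := hideal _ hp z
  have ep := hcl x y ex ey
  have eq := hcl _ z ep ez
  have hfin : Module.Finite k N := Module.finite_of_finrank_pos (by omega)
  have key : ∀ r s t u : k, r • x + s • (x * y) + t • (x * y * z) + u • w = 0 →
      r = 0 ∧ s = 0 ∧ t = 0 ∧ u = 0 := by
    intro r s t u h
    have h' : c • (r • x + s • (x * y) + t • (x * y * z)) + d • (u • w) = 0 := by
      have := congrArg (fun v => e * v) h
      simp only [mul_add, mul_smul_comm, ex, ep, eq, ew, mul_zero] at this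
      rw [← this]; module
    have hu : (d - c) • (u • w) = 0 := by
      have : (d - c) • (u • w) = (c • (r • x + s • (x * y) + t • (x * y * z)) + d • (u • w))
        - c • (r • x + s • (x * y) + t • (x * y * z) + u • w) := by module
      rw [this, h', h]; simp
    have hu' : u • w = 0 := (smul_eq_zero.mp hu).resolve_left (sub_ne_zero.mpr hcd.symm)
    have hu0 : u = 0 := (smul_eq_zero.mp hu').resolve_right hw0
    rw [hu', add_zero] at h
    have hr : r • (x * y * z) = 0 := by
      have := congrArg (fun v => v * y * z) h
      simp only [add_mul, smul_mul_assoc, zero_mul, h4 x hx y hy z hz y hy,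
        h4 x hx y hy y hy z hz, smul_zero, add_zero] at this
      exact this
    have hr0 : r = 0 := (smul_eq_zero.mp hr).resolve_right hne
    subst hr0
    have hs : s • (x * y * z) = 0 := by
      have := congrArg (fun v => v * z) h
      simpa only [add_mul, smul_mul_assoc, zero_mul, zero_smul, zero_add,
        h4 x hx y hy z hz z hz, smul_zero, add_zero] using this
    have hs0 : s = 0 := (smul_eq_zero.mp hs).resolve_right hne
    subst hs0
    simp only [zero_smul, zero_add] at h
    exact ⟨rfl, rfl, (smul_eq_zero.mp h).resolve_right hne, hu0⟩
  have hli : LinearIndependent k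
      (![⟨x, hx⟩, ⟨x * y, hp⟩, ⟨x * y * z, hq⟩, ⟨w, hw⟩] : Fin 4 → N) := by
    rw [Fintype.linearIndependent_iff]
    intro g hg
    have := congrArg (Subtype.val) hg
    simp [Fin.sum_univ_four] at this
    obtain ⟨a, b, c, d⟩ := key _ _ _ _ this
    intro i
    fin_cases i <;> assumption
  have := hli.fintype_card_le_finrank
  simp [hdimN] at this

/-- There is no Jordan algebra `J` over a field `k` of characteristic ≠ 2 with an idempotent
`e` and a nilpotent ideal `N` such that `dim N = 3`, `N^⟨3⟩ ≠ 0`, `N^⟨4⟩ = 0` (so `N` has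
nilpotency type `(1,1,1)`), `N ⊆ J_0(e) + J_1(e)`, and both `N ∩ J_0(e) ≠ 0` and
`N ∩ J_1(e) ≠ 0`. -/
theorem no_type_111_zero_one_split (hchar : (2 : k) ≠ 0)
    (hJordan : ∀ x y : J, ((x * x) * y) * x = (x * x) * (y * x))
    (e : J) (he : e * e = e) (hne : e ≠ 0)
    (N : Submodule k J) (hideal : ∀ x ∈ N, ∀ y : J, x * y ∈ N)
    (hdimN : Module.finrank k ↥N = 3)
    (hN3 : nseries N 2 ≠ ⊥)
    (hN4 : nseries N 3 = ⊥)
    (hsub : N ≤ peirceComp e (0 : k) ⊔ peirceComp e (1 : k))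
    (h0 : N ⊓ peirceComp e (0 : k) ≠ ⊥)
    (h1 : N ⊓ peirceComp e (1 : k) ≠ ⊥) :
    False := by
  have lin := aux_lin hchar hJordan e he
  have two := aux_two (J := J) hchar
  have c0 : ∀ x y : J, e * x = (0 : k) • x → e * y = (0 : k) • y →
      e * (x * y) = (0 : k) • (x * y) := by
    intro x y hx hy
    have := lin x y
    simp only [zero_smul] at hx hy ⊢
    simpa [hx, hy, mul_comm x e] using this.symm
  have c1 : ∀ x y : J, e * x = (1 : k) • x → e * y = (1 : k) • y →
      e * (x * y) = (1 : k) • (x * y) := by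
    intro x y hx hy
    have := lin x y
    simp only [one_smul] at hx hy ⊢
    rw [hx, hy, mul_comm x e, hx, mul_comm y x, mul_comm (x * y) e] at this
    have h2 : e * (x * y) - x * y
      = (e * (x * y) + e * (x * y) + x * y) - (x * y + x * y + e * (x * y)) := by abel
    rw [this, sub_self] at h2
    exact sub_eq_zero.mp h2
  have c01 : ∀ x y : J, e * x = 0 → e * y = y → x * y = 0 := by
    intro x y hx hy
    have a := lin x y
    have b := lin y x
    rw [hx, hy, mul_comm x e, hx, mul_comm y x, mul_comm (x * y) e] at a
    rw [hx, hy, mul_comm y e, hy] at b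
    simp only [zero_mul, mul_zero, zero_add, add_zero, mul_comm y x] at a b
    have : e * (x * y) = 0 := by simpa using a
    rw [b, this]
  have h4 : ∀ x ∈ N, ∀ y ∈ N, ∀ z ∈ N, ∀ t ∈ N, ((x * y) * z) * t = 0 := by
    intro x hx y hy z hz t ht
    have : ((x * y) * z) * t ∈ nseries N 3 :=
      Submodule.subset_span ⟨_, Submodule.subset_span
        ⟨_, Submodule.subset_span ⟨x, hx, y, hy, rfl⟩, z, hz, rfl⟩, t, ht, rfl⟩
    rw [hN4] at this
    simpa using this
  obtain ⟨u, hu, hu0⟩ := Submodule.exists_mem_ne_zero_of_ne_bot h0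
  obtain ⟨v, hv, hv0⟩ := Submodule.exists_mem_ne_zero_of_ne_bot h1
  have z0 : ∀ x ∈ N, ∀ y ∈ N, ∀ z ∈ N, e * x = (0 : k) • x → e * y = (0 : k) • y →
      e * z = (0 : k) • z → x * y * z = 0 := by
    intro x hx y hy z hz ex ey ez
    by_contra hne
    exact aux_main e N hdimN hideal h4 0 1 zero_ne_one c0 x y z v hx hy hz hv.1 ex ey ez hv.2
      hv0 hne
  have z1 : ∀ x ∈ N, ∀ y ∈ N, ∀ z ∈ N, e * x = (1 : k) • x → e * y = (1 : k) • y →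
      e * z = (1 : k) • z → x * y * z = 0 := by
    intro x hx y hy z hz ex ey ez
    by_contra hne
    exact aux_main e N hdimN hideal h4 1 0 one_ne_zero c1 x y z u hx hy hz hu.1 ex ey ez hu.2
      hu0 hne
  have dec : ∀ x ∈ N, ∃ a ∈ N, ∃ b ∈ N, e * a = 0 ∧ e * b = b ∧ x = a + b := by
    intro x hx
    obtain ⟨a, ha, b, hb, rfl⟩ := Submodule.mem_sup.mp (hsub hx)
    have ha' : e * a = 0 := by
      have : e * a = (0 : k) • a := ha
      simpa using this
    have hb' : e * b = b := by
      have : e * b = (1 : k) • b := hb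
      simpa using this
    have hbN : b ∈ N := by
      have := hideal _ hx e
      rwa [mul_comm, mul_add, ha', hb', zero_add] at this
    have haN : a ∈ N := by
      have := N.sub_mem hx hbN
      rwa [add_sub_cancel_right] at this
    exact ⟨a, haN, b, hbN, ha', hb', rfl⟩
  have h3 : ∀ x ∈ N, ∀ y ∈ N, ∀ z ∈ N, x * y * z = 0 := by
    intro x hx y hy z hz
    obtain ⟨a, ha, b, hb, ea, eb, rfl⟩ := dec x hx
    obtain ⟨a', ha', b', hb', ea', eb', rfl⟩ := dec y hy
    obtain ⟨a'', ha'', b'', hb'', ea'', eb'', rfl⟩ := dec z hz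
    have e1 : e * (a * a') = 0 := by simpa using c0 a a' (by simpa using ea) (by simpa using ea')
    have e2 : e * (b * b') = b * b' := by
      simpa using c1 b b' (by simpa using eb) (by simpa using eb')
    have q1 := z0 a ha a' ha' a'' ha'' (by simpa using ea) (by simpa using ea')
      (by simpa using ea'')
    have q2 := z1 b hb b' hb' b'' hb'' (by simpa using eb) (by simpa using eb')
      (by simpa using eb'')
    have q3 := c01 _ _ e1 eb''
    have q4 := c01 _ _ ea'' e2
    rw [mul_comm] at q4
    have q5 := c01 _ _ ea eb'
    have q6 := c01 _ _ ea' eb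
    rw [mul_comm] at q6
    simp only [mul_add, add_mul, q5, q6, q1, q2, q3, q4, zero_mul, add_zero]
  apply hN3
  rw [eq_bot_iff]
  refine Submodule.span_le.mpr ?_
  rintro _ ⟨p, hp, z, hz, rfl⟩
  have hp' : p ∈ Submodule.span k {z : J | ∃ a ∈ N, ∃ b ∈ N, z = a * b} := hp
  clear hp
  change p * z = 0
  induction hp' using Submodule.span_induction with
  | mem p h =>
    obtain ⟨x, hx, y, hy, rfl⟩ := h
    exact h3 x hx y hy z hz
  | zero => simp
  | add p q hp hq h h' => rw [add_mul, h, h', add_zero]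
  | smul r p hp h => rw [smul_mul_assoc, h, smul_zero]
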